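/- arXiv:1110.3601 — 5 statements merged into one kernel-verified Lean document; each statement's English description precedes it below -/
import Mathlib

section
/- Let d be an asymmetric metric on a nonempty set M and let φ : M → M be a bijection with d(φ(x), φ(y)) = d(x, y) for all x, y ∈ M. Suppose there exist a real number c > 0 and a map γ : ℝ → M satisfying d(γ(s), γ(t)) = t − s for all real s ≤ t, and φ(γ(t)) = γ(t + c) for all t ∈ ℝ. Then d(Y, φ(Y)) ≥ c for every Y ∈ M; consequently the translation distance a(φ) = inf_{Y ∈ M} d(Y, φ(Y)) equals c and is attained at every point γ(t). (This is the abstract content of the theorem that a mapping class of infinite order leaving a geodesic of Thurston's asymmetric metric invariant is hyperbolic, with its translation distance attained at any point of the geodesic.) -/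
/-- Under an isometry, the `n`-th iterate moves a point at most `n` times as far as the isometry. -/
lemma dist_iterate_le {M : Type*} {d : M → M → ℝ} (hd_self : ∀ x, d x x = 0)
    (hd_triangle : ∀ x y z, d x z ≤ d x y + d y z) {φ : M → M}
    (hφ_isom : ∀ x y, d (φ x) (φ y) = d x y) (Y : M) (n : ℕ) :
    d Y (φ^[n] Y) ≤ n * d Y (φ Y) := by
  induction n with
  | zero => simp [hd_self]
  | succ n ih =>
    rw [Function.iterate_succ_apply']
    have h := hd_triangle Y (φ Y) (φ (φ^[n] Y))
    rw [hφ_isom] at h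
    push_cast
    linarith

lemma dist_iterate_iterate {M : Type*} {d : M → M → ℝ} {φ : M → M}
    (hφ_isom : ∀ x y, d (φ x) (φ y) = d x y) (x y : M) (n : ℕ) :
    d (φ^[n] x) (φ^[n] y) = d x y := by
  induction n with
  | zero => rfl
  | succ n ih => rw [Function.iterate_succ_apply', Function.iterate_succ_apply', hφ_isom, ih]

lemma iterate_apply_of_translation {M : Type*} {φ : M → M} {γ : ℝ → M} {c : ℝ}
    (hγ_transl : ∀ t : ℝ, φ (γ t) = γ (t + c)) (t : ℝ) (n : ℕ) :
    φ^[n] (γ t) = γ (t + n * c) := by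
  induction n with
  | zero => simp
  | succ n ih =>
    rw [Function.iterate_succ_apply', ih, hγ_transl]
    push_cast
    ring_nf

/-- An isometry of infinite order of an asymmetric metric space that translates
along a geodesic line by `c > 0` has translation distance exactly `c`, attained
at every point of the geodesic. -/
theorem invariant_geodesic_translation
    {M : Type*} [Nonempty M] (d : M → M → ℝ)
    (hd_nonneg : ∀ x y, 0 ≤ d x y)
    (hd_eq : ∀ x y, d x y = 0 ↔ x = y)
    (hd_triangle : ∀ x y z, d x z ≤ d x y + d y z)
    (φ : M → M) (hφ_bij : Function.Bijective φ)
    (hφ_isom : ∀ x y, d (φ x) (φ y) = d x y)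
    (c : ℝ) (hc : 0 < c)
    (γ : ℝ → M)
    (hγ_geod : ∀ s t : ℝ, s ≤ t → d (γ s) (γ t) = t - s)
    (hγ_transl : ∀ t : ℝ, φ (γ t) = γ (t + c)) :
    (∀ Y : M, c ≤ d Y (φ Y)) ∧
    sInf {r : ℝ | ∃ Y : M, r = d Y (φ Y)} = c ∧
    (∀ t : ℝ, d (γ t) (φ (γ t)) = sInf {r : ℝ | ∃ Y : M, r = d Y (φ Y)}) := by
  have lower : ∀ Y : M, c ≤ d Y (φ Y) := by
    intro Y
    by_contra! hlt
    obtain ⟨n, hn⟩ := exists_nat_gt ((d (γ 0) Y + d Y (γ 0)) / (c - d Y (φ Y)))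
    rw [div_lt_iff₀ (sub_pos.mpr hlt)] at hn
    have hgeod : d (γ 0) (φ^[n] (γ 0)) = n * c := by
      rw [iterate_apply_of_translation hγ_transl, hγ_geod _ _ (by simp; positivity)]
      ring
    have h₁ := hd_triangle (γ 0) Y (φ^[n] (γ 0))
    have h₂ := hd_triangle Y (φ^[n] Y) (φ^[n] (γ 0))
    rw [dist_iterate_iterate hφ_isom] at h₂
    have h₃ := dist_iterate_le (fun x => (hd_eq x x).2 rfl) hd_triangle hφ_isom Y n
    linarith
  have attained : ∀ t : ℝ, d (γ t) (φ (γ t)) = c := by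
    intro t
    rw [hγ_transl, hγ_geod _ _ (by linarith)]
    ring
  have least : IsLeast {r : ℝ | ∃ Y : M, r = d Y (φ Y)} c :=
    ⟨⟨γ 0, (attained 0).symm⟩, by rintro r ⟨Y, rfl⟩; exact lower Y⟩
  exact ⟨lower, least.csInf_eq, fun t => (attained t).trans least.csInf_eq.symm⟩
end

section
/- Let d be an asymmetric metric on a nonempty set M and let φ : M → M be a bijection with d(φ(x), φ(y)) = d(x, y) for all x, y ∈ M. Suppose X ∈ M satisfies d(X, φⁿ(X)) = n · d(X, φ(X)) for every natural number n. Then for every m ≥ 1 the translation distance of φᵐ equals m · d(X, φ(X)) and is attained at X; in particular a(φ) = d(X, φ(X)). -/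
/-- An isometry of an asymmetric metric has isometric iterates. -/
theorem dist_iterate_iterate_of_isometry {M : Type*} {d : M → M → ℝ} {φ : M → M}
    (hφ : ∀ x y, d (φ x) (φ y) = d x y) (n : ℕ) (x y : M) :
    d (φ^[n] x) (φ^[n] y) = d x y := by
  induction n with
  | zero => rfl
  | succ k ih => rw [Function.iterate_succ_apply', Function.iterate_succ_apply', hφ, ih]

/-- The displacement of the `n`-th iterate of an isometry is at most `n` times the
displacement of the isometry itself. -/
theorem dist_iterate_le_mul_of_isometry {M : Type*} {d : M → M → ℝ} {φ : M → M}
    (hd_self : ∀ x, d x x = 0) (hd_triangle : ∀ x y z, d x z ≤ d x y + d y z)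
    (hφ : ∀ x y, d (φ x) (φ y) = d x y) (n : ℕ) (x : M) :
    d x (φ^[n] x) ≤ n * d x (φ x) := by
  induction n with
  | zero => simp [hd_self]
  | succ k ih =>
    have h := hd_triangle x (φ^[k] x) (φ^[k + 1] x)
    rw [Function.iterate_succ_apply φ k x, dist_iterate_iterate_of_isometry hφ] at h
    rw [Function.iterate_succ_apply]
    push_cast
    linarith

/-- A point whose orbit under an isometry has displacement growing linearly minimizes
the displacement of the isometry. -/
theorem dist_apply_le_of_linear_orbit {M : Type*} {d : M → M → ℝ} {φ : M → M}
    (hd_self : ∀ x, d x x = 0) (hd_triangle : ∀ x y z, d x z ≤ d x y + d y z)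
    (hφ : ∀ x y, d (φ x) (φ y) = d x y) {X : M}
    (hX : ∀ n : ℕ, d X (φ^[n] X) = n * d X (φ X)) (Y : M) :
    d X (φ X) ≤ d Y (φ Y) := by
  by_contra! hlt
  obtain ⟨n, hn⟩ := exists_nat_gt ((d X Y + d Y X) / (d X (φ X) - d Y (φ Y)))
  rw [div_lt_iff₀ (sub_pos.mpr hlt)] at hn
  have h₁ := hd_triangle X Y (φ^[n] X)
  have h₂ := hd_triangle Y (φ^[n] Y) (φ^[n] X)
  rw [dist_iterate_iterate_of_isometry hφ] at h₂
  have h₃ := dist_iterate_le_mul_of_isometry hd_self hd_triangle hφ n Y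
  rw [hX] at h₁
  linarith

/-- If an isometry `φ` of an asymmetric metric space satisfies
`d(X, φⁿ(X)) = n · d(X, φ(X))` for all `n`, then for every `m ≥ 1` the
translation distance of `φᵐ` equals `m · d(X, φ(X))` and is attained at `X`;
in particular the translation distance of `φ` equals `d(X, φ(X))`. -/
theorem translation_distance_of_linear_orbit
    {M : Type*} [Nonempty M] (d : M → M → ℝ)
    (hd_nonneg : ∀ x y, 0 ≤ d x y)
    (hd_eq : ∀ x y, d x y = 0 ↔ x = y)
    (hd_triangle : ∀ x y z, d x z ≤ d x y + d y z)
    (φ : M → M) (hφ_bij : Function.Bijective φ)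
    (hφ_isom : ∀ x y, d (φ x) (φ y) = d x y)
    (X : M)
    (hX : ∀ n : ℕ, d X (φ^[n] X) = n * d X (φ X)) :
    (∀ m : ℕ, 1 ≤ m →
      sInf {r : ℝ | ∃ Y : M, r = d Y (φ^[m] Y)} = m * d X (φ X) ∧
      d X (φ^[m] X) = sInf {r : ℝ | ∃ Y : M, r = d Y (φ^[m] Y)}) ∧
    sInf {r : ℝ | ∃ Y : M, r = d Y (φ Y)} = d X (φ X) := by
  have hd_self : ∀ x, d x x = 0 := fun x => (hd_eq x x).mpr rfl
  have key : ∀ m : ℕ, sInf {r : ℝ | ∃ Y : M, r = d Y (φ^[m] Y)} = m * d X (φ X) := by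
    intro m
    rw [← hX m]
    refine IsLeast.csInf_eq ⟨⟨X, rfl⟩, ?_⟩
    rintro _ ⟨Y, rfl⟩
    refine dist_apply_le_of_linear_orbit hd_self hd_triangle
      (dist_iterate_iterate_of_isometry hφ_isom m) (fun n => ?_) Y
    rw [← Function.iterate_mul, hX, hX]
    push_cast
    ring
  refine ⟨fun m _ => ⟨key m, (hX m).trans (key m).symm⟩, ?_⟩
  simpa using key 1
end

section
/- Let M be a nonempty proper metric space and let a group G act on M by isometries and properly discontinuously. Let φ ∈ G and set a(φ) = inf_{X ∈ M} dist(X, φ·X). Suppose there exist a sequence (Xₖ) in M with dist(Xₖ, φ·Xₖ) → a(φ) and a sequence (ψₖ) in G such that the sequence (ψₖ·Xₖ) converges in M. Then a(φ) is attained: there exists Z ∈ M with dist(Z, φ·Z) = a(φ). (This is the abstract form of Bers' compactness argument used to prove that every irreducible mapping class is either elliptic or hyperbolic for Thurston's asymmetric metric.) -/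
open Filter Topology

/-- Bers' compactness argument: if a group `G` acts isometrically and properly
discontinuously on a nonempty proper metric space `M`, and some minimizing
sequence for the translation distance of `φ ∈ G` can be brought back to a
convergent sequence by elements of `G`, then the translation distance of `φ`
is attained. -/
theorem translation_distance_attained_of_recompactified
    {M : Type*} [MetricSpace M] [ProperSpace M] [Nonempty M]
    {G : Type*} [Group G] [MulAction G M]
    (h_isom : ∀ (g : G) (x y : M), dist (g • x) (g • y) = dist x y)
    (h_pd : ∀ K L : Set M, IsCompact K → IsCompact L →
      {g : G | ((fun x => g • x) '' K ∩ L).Nonempty}.Finite)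
    (φ : G)
    (X : ℕ → M)
    (hX : Tendsto (fun k => dist (X k) (φ • X k)) atTop
      (𝓝 (sInf {r : ℝ | ∃ Y : M, r = dist Y (φ • Y)})))
    (ψ : ℕ → G)
    (hψ : ∃ Y : M, Tendsto (fun k => ψ k • X k) atTop (𝓝 Y)) :
    ∃ Z : M, dist Z (φ • Z) = sInf {r : ℝ | ∃ Y : M, r = dist Y (φ • Y)} := by
  obtain ⟨Y, hY⟩ := hψ
  set a := sInf {r : ℝ | ∃ Y : M, r = dist Y (φ • Y)}
  set g : ℕ → G := fun k => ψ k * φ * (ψ k)⁻¹ with hg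
  have h_conj (k : ℕ) : dist (ψ k • X k) (g k • ψ k • X k) = dist (X k) (φ • X k) := by
    rw [← h_isom (ψ k) (X k)]
    simp [hg, mul_smul]
  have h_lim : Tendsto (fun k => dist Y (g k • Y)) atTop (𝓝 a) := by
    have h_diff : Tendsto (fun k => dist Y (g k • Y) - dist (X k) (φ • X k)) atTop (𝓝 0) := by
      refine squeeze_zero_norm (a := fun k => 2 * dist (ψ k • X k) Y) (fun k => ?_) ?_
      · have h := dist_dist_dist_le Y (g k • Y) (ψ k • X k) (g k • ψ k • X k)
        rw [h_conj, h_isom, Real.dist_eq, dist_comm Y (ψ k • X k)] at h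
        rw [Real.norm_eq_abs]
        linarith
      · simpa using (tendsto_iff_dist_tendsto_zero.mp hY).const_mul 2
    simpa using h_diff.add hX
  obtain ⟨N, hN⟩ := eventually_atTop.mp (h_lim.eventually_le_const (lt_add_one a))
  have h_fin : (g '' Set.Ici N).Finite := by
    refine (h_pd {Y} (Metric.closedBall Y (a + 1)) isCompact_singleton
      (isCompact_closedBall _ _)).subset ?_
    rintro _ ⟨k, hk, rfl⟩
    exact ⟨g k • Y, ⟨Y, rfl, rfl⟩, Metric.mem_closedBall'.mpr (hN k hk)⟩
  have h_mem : a ∈ (fun γ : G => dist Y (γ • Y)) '' (g '' Set.Ici N) :=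
    (h_fin.image _).isClosed.mem_of_tendsto h_lim <| (eventually_ge_atTop N).mono
      fun k hk => ⟨g k, ⟨k, hk, rfl⟩, rfl⟩
  obtain ⟨_, ⟨k, -, rfl⟩, hk⟩ := h_mem
  refine ⟨(ψ k)⁻¹ • Y, ?_⟩
  rw [← hk, ← h_isom (ψ k)]
  simp [hg, mul_smul]
end

section
/- Let M be a nonempty proper metric space and let a group G act on M by isometries and properly discontinuously. Let φ ∈ G with translation distance a(φ) = inf_{X ∈ M} dist(X, φ·X), and suppose a(φ) is not attained, i.e. there is no Z ∈ M with dist(Z, φ·Z) = a(φ). Then for every compact set K ⊆ M and every sequence (Xₖ) in M with dist(Xₖ, φ·Xₖ) → a(φ), only finitely many of the Xₖ lie in the saturation G·K = {g·x : g ∈ G, x ∈ K}. (This is the abstract form of the corollary that for a parabolic or pseudo-hyperbolic mapping class, every minimizing sequence eventually leaves every thick part of Teichmüller space.) -/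
open Filter Topology

/-- Conjugating an isometry moves its displacement function by the conjugating element. -/
theorem dist_conj_smul {M G : Type*} [MetricSpace M] [Group G] [MulAction G M]
    (h_isom : ∀ (g : G) (x y : M), dist (g • x) (g • y) = dist x y) (φ g : G) (x : M) :
    dist x ((g⁻¹ * φ * g) • x) = dist (g • x) (φ • g • x) := by
  rw [← h_isom g x, smul_smul, smul_smul]
  congr 2
  group

/-- A continuous function exceeding `a` pointwise on a compact set is uniformly separated
from `a` there. -/
theorem IsCompact.exists_forall_lt_le {M : Type*} [TopologicalSpace M] {K : Set M}
    (hK : IsCompact K) {f : M → ℝ} (hf : Continuous f) {a : ℝ} (h : ∀ x ∈ K, a < f x) :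
    ∃ m, a < m ∧ ∀ x ∈ K, m ≤ f x := by
  rcases K.eq_empty_or_nonempty with rfl | hne
  · exact ⟨a + 1, by linarith, by simp⟩
  · obtain ⟨z, hz, hmin⟩ := hK.exists_isMinOn hne hf.continuousOn
    exact ⟨f z, h z hz, fun x hx => hmin hx⟩

/-- If the translation distance of `φ ∈ G` acting isometrically and properly
discontinuously on a nonempty proper metric space is not attained, then every
minimizing sequence eventually leaves the saturation `G·K` of every compact
set `K`: only finitely many terms of the sequence lie in `G·K`. -/
theorem minimizing_sequence_leaves_saturation
    {M : Type*} [MetricSpace M] [ProperSpace M] [Nonempty M]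
    {G : Type*} [Group G] [MulAction G M]
    (h_isom : ∀ (g : G) (x y : M), dist (g • x) (g • y) = dist x y)
    (h_pd : ∀ K L : Set M, IsCompact K → IsCompact L →
      {g : G | ((fun x => g • x) '' K ∩ L).Nonempty}.Finite)
    (φ : G)
    (h_not_attained :
      ¬ ∃ Z : M, dist Z (φ • Z) = sInf {r : ℝ | ∃ Y : M, r = dist Y (φ • Y)}) :
    ∀ K : Set M, IsCompact K →
      ∀ X : ℕ → M,
        Tendsto (fun k => dist (X k) (φ • X k)) atTop
          (𝓝 (sInf {r : ℝ | ∃ Y : M, r = dist Y (φ • Y)})) →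
        {k : ℕ | ∃ g : G, ∃ x ∈ K, X k = g • x}.Finite := by
  intro K hK X hX
  set a := sInf {r : ℝ | ∃ Y : M, r = dist Y (φ • Y)}
  have h_lt : ∀ Y : M, a < dist Y (φ • Y) := fun Y =>
    lt_of_le_of_ne (csInf_le ⟨0, by rintro _ ⟨Z, rfl⟩; exact dist_nonneg⟩ ⟨Y, rfl⟩)
      fun h => h_not_attained ⟨Y, h.symm⟩
  have h_fin := h_pd K (Metric.cthickening (a + 1) K) hK hK.cthickening
  have h_avoid : ∀ ψ : G, ∀ᶠ k in atTop, ∀ g : G, g⁻¹ * φ * g = ψ → ∀ x ∈ K, X k ≠ g • x := by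
    intro ψ
    by_cases hψ : ∃ h : G, h⁻¹ * φ * h = ψ
    · obtain ⟨h, rfl⟩ := hψ
      have h_cont : Continuous fun x : M => dist x ((h⁻¹ * φ * h) • x) :=
        continuous_id.dist (Isometry.of_dist_eq (h_isom _)).continuous
      obtain ⟨m, ham, hm⟩ := hK.exists_forall_lt_le h_cont (a := a) fun x _ => by
        rw [dist_conj_smul h_isom]
        exact h_lt _
      filter_upwards [hX.eventually_lt_const ham] with k hk g hg x hx hXk
      have hmx := hm x hx
      rw [← hg, dist_conj_smul h_isom, ← hXk] at hmx
      exact hmx.not_gt hk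
    · exact Eventually.of_forall fun k g hg => (hψ ⟨g, hg⟩).elim
  have h_all := h_fin.eventually_all.2 fun ψ _ => h_avoid ψ
  have h_ev : ∀ᶠ k in atTop, ¬ ∃ g : G, ∃ x ∈ K, X k = g • x := by
    filter_upwards [h_all, hX.eventually_lt_const (lt_add_one a)] with k hk hlt
    rintro ⟨g, x, hx, hXk⟩
    refine hk (g⁻¹ * φ * g) ⟨_, ⟨x, hx, rfl⟩, ?_⟩ g rfl x hx hXk
    refine Metric.mem_cthickening_of_dist_le _ x _ _ hx ?_
    rw [dist_comm, dist_conj_smul h_isom, ← hXk]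
    exact hlt.le
  rw [← Nat.cofinite_eq_atTop, eventually_cofinite] at h_ev
  simpa only [not_not] using h_ev
end

section
/- Let d be an asymmetric metric on a nonempty set M and let φ : M → M be a bijection with d(φ(x), φ(y)) = d(x, y) for all x, y ∈ M. Let X ∈ M, set c = d(X, φ(X)), assume c > 0, and assume d(φ^{-k}(X), φ^{k}(X)) = 2kc for every natural number k. Let γ : [0, c] → M satisfy γ(0) = X, γ(c) = φ(X), and d(γ(s), γ(t)) = t − s for all 0 ≤ s ≤ t ≤ c. Define R : ℝ → M by R(t + kc) = φᵏ(γ(t)) for t ∈ [0, c) and k ∈ ℤ. Then d(R(s), R(t)) = t − s for all real s ≤ t; that is, R is a geodesic line, it is invariant under φ, and φ(R(t)) = R(t + c) for all t. (This is the abstract content of the construction showing that a pseudo-Anosov mapping class, a power of which translates along a stretch line, itself leaves a geodesic of Thurston's asymmetric metric invariant.) -/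
/-- Concatenation construction of an invariant geodesic: if `φ` is an isometry
of an asymmetric metric space, `c = d(X, φ(X)) > 0`, the iterates satisfy
`d(φ⁻ᵏ(X), φᵏ(X)) = 2kc`, and `γ : [0, c] → M` is a geodesic segment from `X`
to `φ(X)`, then the map `R` defined by `R(t + kc) = φᵏ(γ(t))` for `t ∈ [0, c)`
and `k ∈ ℤ` is a geodesic line with `φ(R(t)) = R(t + c)` for all `t`;
in particular `R` is invariant under `φ`. -/
theorem concatenated_invariant_geodesic
    {M : Type*} [Nonempty M] (d : M → M → ℝ)
    (hd_nonneg : ∀ x y, 0 ≤ d x y)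
    (hd_eq : ∀ x y, d x y = 0 ↔ x = y)
    (hd_triangle : ∀ x y z, d x z ≤ d x y + d y z)
    (φ : Equiv.Perm M)
    (hφ_isom : ∀ x y, d (φ x) (φ y) = d x y)
    (X : M) (c : ℝ) (hc_def : d X (φ X) = c) (hc_pos : 0 < c)
    (h_iter : ∀ k : ℕ, d ((φ ^ (-(k : ℤ))) X) ((φ ^ (k : ℤ)) X) = 2 * k * c)
    (γ : ℝ → M)
    (hγ0 : γ 0 = X) (hγc : γ c = φ X)
    (hγ_geod : ∀ s t : ℝ, 0 ≤ s → s ≤ t → t ≤ c → d (γ s) (γ t) = t - s)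
    (R : ℝ → M)
    (hR_def : ∀ (k : ℤ) (t : ℝ), 0 ≤ t → t < c →
      R (t + k * c) = (φ ^ k) (γ t)) :
    (∀ s t : ℝ, s ≤ t → d (R s) (R t) = t - s) ∧
    (∀ t : ℝ, φ (R t) = R (t + c)) := by
  have hR_closed : ∀ (k : ℤ) (t : ℝ), 0 ≤ t → t ≤ c → R (t + k * c) = (φ ^ k) (γ t) := by
    intro k t h0 h1
    rcases h1.lt_or_eq with h | rfl
    · exact hR_def k t h0 h
    · have h := hR_def (k + 1) 0 le_rfl hc_pos
      rw [hγ0] at h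
      rw [hγc, ← Equiv.Perm.mul_apply, ← zpow_add_one, ← h]
      congr 1
      push_cast
      ring
  have hpow_isom : ∀ (k : ℤ) (x y : M), d ((φ ^ k) x) ((φ ^ k) y) = d x y := by
    intro k
    induction k with
    | zero => simp
    | succ n ih =>
      intro x y
      rw [zpow_add_one, Equiv.Perm.mul_apply, Equiv.Perm.mul_apply, ih, hφ_isom]
    | pred n ih =>
      intro x y
      rw [zpow_sub_one, Equiv.Perm.mul_apply, Equiv.Perm.mul_apply, ih, ← hφ_isom]
      simp
  have hdecomp : ∀ s : ℝ, ∃ k : ℤ, k * c ≤ s ∧ s < (k + 1) * c := fun s =>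
    ⟨⌊s / c⌋, (le_div_iff₀ hc_pos).1 (Int.floor_le _),
      (div_lt_iff₀ hc_pos).1 (Int.lt_floor_add_one _)⟩
  have hlocal : ∀ (k : ℤ) (s t : ℝ), k * c ≤ s → s ≤ t → t ≤ (k + 1) * c →
      d (R s) (R t) = t - s := by
    intro k s t h1 h2 h3
    have hs := hR_closed k (s - k * c) (by linarith) (by linarith)
    have ht := hR_closed k (t - k * c) (by linarith) (by linarith)
    rw [sub_add_cancel] at hs ht
    rw [hs, ht, hpow_isom, hγ_geod _ _ (by linarith) (by linarith) (by linarith)]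
    ring
  have hupper_aux : ∀ (n : ℕ) (k : ℤ) (s t : ℝ), k * c ≤ s → s ≤ (k + 1) * c → s ≤ t →
      t ≤ (k + 1 + n) * c → d (R s) (R t) ≤ t - s := by
    intro n
    induction n with
    | zero =>
      intro k s t h1 _ h3 h4
      exact (hlocal k s t h1 h3 (by simpa using h4)).le
    | succ n ih =>
      intro k s t h1 h2 h3 h4
      push_cast at h4
      have hn : 0 ≤ (n : ℝ) * c := by positivity
      rcases le_total t ((k + 1 + n) * c) with h | h
      · exact ih k s t h1 h2 h3 h
      · have ha := ih k s ((k + 1 + n) * c) h1 h2 (by linarith) le_rfl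
        have hb := hlocal (k + 1 + n) ((k + 1 + n) * c) t (by push_cast; exact le_rfl) h
          (by push_cast; linarith)
        linarith [hd_triangle (R s) (R ((k + 1 + n) * c)) (R t)]
  have hupper : ∀ s t : ℝ, s ≤ t → d (R s) (R t) ≤ t - s := by
    intro s t h
    obtain ⟨k, h1, h2⟩ := hdecomp s
    obtain ⟨n, hn⟩ := exists_nat_ge (t / c - (k + 1))
    refine hupper_aux n k s t h1 h2.le h ((div_le_iff₀ hc_pos).1 ?_)
    linarith
  have hR_orbit : ∀ k : ℤ, R (k * c) = (φ ^ k) X := by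
    intro k
    simpa [hγ0] using hR_def k 0 le_rfl hc_pos
  refine ⟨fun s t h => le_antisymm (hupper s t h) ?_, fun t => ?_⟩
  · obtain ⟨N, hN⟩ := exists_nat_ge (max (-s / c) (t / c))
    have h1 := (div_le_iff₀ hc_pos).1 ((le_max_left _ _).trans hN)
    have h2 := (div_le_iff₀ hc_pos).1 ((le_max_right _ _).trans hN)
    have h3 := h_iter N
    rw [← hR_orbit, ← hR_orbit] at h3
    push_cast at h3
    have h4 := hupper (-N * c) s (by linarith)
    have h5 := hupper t (N * c) h2
    linarith [hd_triangle (R (-N * c)) (R s) (R (N * c)), hd_triangle (R s) (R t) (R (N * c))]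
  · obtain ⟨k, h1, h2⟩ := hdecomp t
    have ha := hR_def k (t - k * c) (by linarith) (by linarith)
    have hb := hR_def (k + 1) (t - k * c) (by linarith) (by linarith)
    rw [sub_add_cancel] at ha
    rw [ha, ← Equiv.Perm.mul_apply, ← zpow_one_add, add_comm 1 k, ← hb]
    congr 1
    push_cast
    ring
end
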